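/- arXiv:2201.02828 — 2 statements merged into one kernel-verified Lean document; each statement's English description precedes it below -/
import Mathlib

section
/- Assume (A.1) and fix α > 0. If v : S × Γ → ℝ is bounded and continuous, then Tv is bounded and continuous, and ‖Tv‖ ≤ |γ|·(z^+ − z^-) + ‖v‖, where ‖·‖ denotes the supremum norm on S × Γ. -/
open MeasureTheory Set

noncomputable section

/-- Standard scalar product on `ℝ^d`. -/
def ip {d : ℕ} (x y : Fin d → ℝ) : ℝ := ∑ i, x i * y i

/-- `G(x,y) = (x·y)/⟨x,y⟩` (componentwise product, normalised). -/
def Gmap {d : ℕ} (x y : Fin d → ℝ) : Fin d → ℝ := fun i => x i * y i / ip x y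

/-- Entropic utility `μ^γ(X) = (1/γ) ln E[e^{γX}]`. -/
def entropic {Ω : Type*} [MeasurableSpace Ω] (γ : ℝ) (P : Measure Ω) (X : Ω → ℝ) : ℝ :=
  (1 / γ) * Real.log (∫ ω, Real.exp (γ * X ω) ∂P)

/-- The parameter set `Γ = [min(γ,0), max(γ,0)] \ {0}`. -/
def Gam (γ : ℝ) : Set ℝ := Icc (min γ 0) (max γ 0) \ {0}

/-- The discounted Bellman operator
`(Tv)(π,δ) = δ ⨆_{π' ∈ S} μ^δ(ln⟨π',w⟩ + ln s(π,π') + δ⁻¹ v(G(π',w), δe^{-α}))`. -/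
def TOp {d : ℕ} {Ω : Type*} [MeasurableSpace Ω] (P : Measure Ω)
    (s : (Fin d → ℝ) → (Fin d → ℝ) → ℝ) (r : Ω → Fin d → ℝ) (α : ℝ)
    (v : (Fin d → ℝ) → ℝ → ℝ) : (Fin d → ℝ) → ℝ → ℝ :=
  fun π δ => δ * sSup ((fun π' => entropic δ P (fun ω =>
      Real.log (ip π' (fun i => Real.exp (r ω i))) + Real.log (s π π') +
        δ⁻¹ * v (Gmap π' (fun i => Real.exp (r ω i))) (δ * Real.exp (-α)))) ''
      stdSimplex ℝ (Fin d))

/-- Supremum norm over `S × Γ`. -/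
def supNormSG {d : ℕ} (γ : ℝ) (f : (Fin d → ℝ) → ℝ → ℝ) : ℝ :=
  sSup {y | ∃ π ∈ stdSimplex ℝ (Fin d), ∃ δ ∈ Gam γ, y = |f π δ|}

section SimplexLogReturn

variable {d : ℕ} {x : Fin d → ℝ}

lemma exp_le_ip_exp (hx : x ∈ stdSimplex ℝ (Fin d)) {y : Fin d → ℝ} {m : ℝ}
    (hm : ∀ i, m ≤ y i) : Real.exp m ≤ ip x (fun i => Real.exp (y i)) := by
  calc Real.exp m = ∑ i, x i * Real.exp m := by rw [← Finset.sum_mul, hx.2, one_mul]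
    _ ≤ _ := Finset.sum_le_sum fun i _ =>
      mul_le_mul_of_nonneg_left (Real.exp_le_exp.2 (hm i)) (hx.1 i)

lemma ip_exp_le_exp (hx : x ∈ stdSimplex ℝ (Fin d)) {y : Fin d → ℝ} {m : ℝ}
    (hm : ∀ i, y i ≤ m) : ip x (fun i => Real.exp (y i)) ≤ Real.exp m := by
  calc _ ≤ ∑ i, x i * Real.exp m := Finset.sum_le_sum fun i _ =>
      mul_le_mul_of_nonneg_left (Real.exp_le_exp.2 (hm i)) (hx.1 i)
    _ = Real.exp m := by rw [← Finset.sum_mul, hx.2, one_mul]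

lemma ip_exp_pos (hx : x ∈ stdSimplex ℝ (Fin d)) (y : Fin d → ℝ) :
    0 < ip x (fun i => Real.exp (y i)) :=
  (Real.exp_pos _).trans_le <| exp_le_ip_exp hx (m := -∑ j, |y j|) fun i => by
    have := Finset.single_le_sum (f := fun j => |y j|) (fun j _ => abs_nonneg _)
      (Finset.mem_univ i)
    linarith [neg_abs_le (y i)]

lemma abs_log_ip_exp_le (hx : x ∈ stdSimplex ℝ (Fin d)) (y : Fin d → ℝ) :
    |Real.log (ip x (fun i => Real.exp (y i)))| ≤ ∑ i, |y i| := by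
  have h (i) := Finset.single_le_sum (f := fun j => |y j|) (fun j _ => abs_nonneg _)
      (Finset.mem_univ i)
  rw [abs_le, Real.le_log_iff_exp_le (ip_exp_pos hx y), Real.log_le_iff_le_exp (ip_exp_pos hx y)]
  exact ⟨exp_le_ip_exp hx fun i => by linarith [neg_abs_le (y i), h i],
    ip_exp_le_exp hx fun i => (le_abs_self _).trans (h i)⟩

lemma exp_mul_log_ip_exp_le (hd : 0 < d) (hx : x ∈ stdSimplex ℝ (Fin d)) (y : Fin d → ℝ)
    (γ : ℝ) :
    Real.exp (γ * Real.log (ip x (fun i => Real.exp (y i)))) ≤ ∑ i, Real.exp (γ * y i) := by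
  have hpos := ip_exp_pos hx y
  have hne : (Finset.univ : Finset (Fin d)).Nonempty := ⟨⟨0, hd⟩, Finset.mem_univ _⟩
  obtain ⟨k, hk⟩ : ∃ k, γ * Real.log (ip x (fun i => Real.exp (y i))) ≤ γ * y k := by
    rcases le_total 0 γ with hγ | hγ
    · obtain ⟨k, -, hk⟩ := Finset.exists_max_image _ y hne
      exact ⟨k, mul_le_mul_of_nonneg_left ((Real.log_le_iff_le_exp hpos).2
        (ip_exp_le_exp hx fun i => hk i (Finset.mem_univ i))) hγ⟩
    · obtain ⟨k, -, hk⟩ := Finset.exists_min_image _ y hne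
      exact ⟨k, mul_le_mul_of_nonpos_left ((Real.le_log_iff_exp_le hpos).2
        (exp_le_ip_exp hx fun i => hk i (Finset.mem_univ i))) hγ⟩
  exact (Real.exp_le_exp.2 hk).trans <| Finset.single_le_sum
    (f := fun i => Real.exp (γ * y i)) (fun i _ => (Real.exp_pos _).le) (Finset.mem_univ k)

lemma Gmap_exp_mem_stdSimplex (hx : x ∈ stdSimplex ℝ (Fin d)) (y : Fin d → ℝ) :
    Gmap x (fun i => Real.exp (y i)) ∈ stdSimplex ℝ (Fin d) := by
  have hpos := ip_exp_pos hx y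
  refine ⟨fun i => div_nonneg (mul_nonneg (hx.1 i) (Real.exp_pos _).le) hpos.le, ?_⟩
  simp only [Gmap]
  rw [← Finset.sum_div]
  exact div_self hpos.ne'

lemma continuous_ip_left (y : Fin d → ℝ) : Continuous fun x => ip x y := by
  unfold ip; fun_prop

lemma continuous_Gmap_exp (y : Fin d → ℝ) :
    Continuous fun x : stdSimplex ℝ (Fin d) => Gmap x.1 (fun i => Real.exp (y i)) := by
  refine continuous_pi fun i => Continuous.div
    (((continuous_apply i).comp continuous_subtype_val).mul continuous_const)
    ((continuous_ip_left _).comp continuous_subtype_val) fun x => (ip_exp_pos x.2 y).ne'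

lemma continuous_log_ip_exp (y : Fin d → ℝ) :
    Continuous fun x : stdSimplex ℝ (Fin d) => Real.log (ip x.1 (fun i => Real.exp (y i))) :=
  ((continuous_ip_left _).comp continuous_subtype_val).log fun x => (ip_exp_pos x.2 y).ne'

end SimplexLogReturn

section Gam

variable {γ δ : ℝ}

lemma exists_mul_eq_of_mem_Gam (hδ : δ ∈ Gam γ) : ∃ t ∈ Ioc (0 : ℝ) 1, δ = t * γ := by
  obtain ⟨⟨h1, h2⟩, h3⟩ := hδ
  have h3 : δ ≠ 0 := h3
  rcases lt_trichotomy γ 0 with hγ | hγ | hγ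
  · rw [min_eq_left hγ.le] at h1
    rw [max_eq_right hγ.le] at h2
    exact ⟨δ / γ, ⟨div_pos_of_neg_of_neg (lt_of_le_of_ne h2 h3) hγ,
      (div_le_one_of_neg hγ).2 h1⟩, (div_mul_cancel₀ δ hγ.ne).symm⟩
  · subst hγ
    simp only [min_self, max_self] at h1 h2
    exact absurd (le_antisymm h2 h1) h3
  · rw [min_eq_right hγ.le] at h1
    rw [max_eq_left hγ.le] at h2
    exact ⟨δ / γ, ⟨div_pos (lt_of_le_of_ne h1 h3.symm) hγ,
      (div_le_one hγ).2 h2⟩, (div_mul_cancel₀ δ hγ.ne').symm⟩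

lemma mul_mem_Gam (hδ : δ ∈ Gam γ) {c : ℝ} (hc : c ∈ Ioc (0 : ℝ) 1) : δ * c ∈ Gam γ := by
  obtain ⟨⟨h1, h2⟩, h3⟩ := hδ
  refine ⟨⟨?_, ?_⟩, mul_ne_zero h3 hc.1.ne'⟩
  · nlinarith [min_le_right γ 0, hc.1, hc.2]
  · nlinarith [le_max_right γ 0, hc.1, hc.2]

lemma self_mem_Gam (hγ : γ ≠ 0) : γ ∈ Gam γ :=
  ⟨⟨min_le_left _ _, le_max_left _ _⟩, hγ⟩

lemma exp_mul_le_one_add_exp_mul (hδ : δ ∈ Gam γ) (z : ℝ) :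
    Real.exp (δ * z) ≤ 1 + Real.exp (γ * z) := by
  obtain ⟨t, ht, rfl⟩ := exists_mul_eq_of_mem_Gam hδ
  rcases le_total 0 (γ * z) with h | h
  · have : Real.exp (t * γ * z) ≤ Real.exp (γ * z) := Real.exp_le_exp.2 (by nlinarith [ht.2])
    linarith
  · have : Real.exp (t * γ * z) ≤ 1 := Real.exp_le_one_iff.2 (by nlinarith [ht.1])
    linarith [Real.exp_pos (γ * z)]

end Gam

section LogMoment

variable {Ω : Type*} [MeasurableSpace Ω] {P : Measure Ω} [IsProbabilityMeasure P] {X : Ω → ℝ}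

lemma integral_le_log_integral_exp (hX : Integrable X P)
    (hexp : Integrable (fun ω => Real.exp (X ω)) P) :
    ∫ ω, X ω ∂P ≤ Real.log (∫ ω, Real.exp (X ω) ∂P) := by
  set m := ∫ ω, X ω ∂P
  rw [Real.le_log_iff_exp_le (integral_exp_pos hexp)]
  have h : ∫ ω, Real.exp m * (1 + (X ω - m)) ∂P ≤ ∫ ω, Real.exp (X ω) ∂P := by
    refine integral_mono (((integrable_const _).add (hX.sub (integrable_const _))).const_mul _)
      hexp fun ω => ?_
    have h1 : Real.exp (X ω) = Real.exp m * Real.exp (X ω - m) := by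
      rw [← Real.exp_add]; ring_nf
    rw [h1]
    exact mul_le_mul_of_nonneg_left (by linarith [Real.add_one_le_exp (X ω - m)])
      (Real.exp_pos _).le
  have h0 : ∫ ω, (1 + (X ω - m)) ∂P = 1 := by
    have h1 : ∫ ω, (X ω - m) ∂P = 0 := by
      rw [integral_sub hX (integrable_const _)]
      simp [m]
    have h2 : Integrable (fun ω => X ω - m) P := hX.sub (integrable_const _)
    rw [integral_add (integrable_const _) h2, h1]
    simp
  rwa [integral_const_mul, h0, mul_one] at h

lemma log_integral_exp_mul_le (hexp : Integrable (fun ω => Real.exp (X ω)) P) {t : ℝ}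
    (ht : t ∈ Ioc (0 : ℝ) 1) (hexp' : Integrable (fun ω => Real.exp (t * X ω)) P) :
    Real.log (∫ ω, Real.exp (t * X ω) ∂P) ≤ t * Real.log (∫ ω, Real.exp (X ω) ∂P) := by
  have hA := integral_exp_pos hexp
  set A := ∫ ω, Real.exp (X ω) ∂P with hAdef
  rw [Real.log_le_iff_le_exp (integral_exp_pos hexp')]
  have h : ∫ ω, Real.exp (t * X ω) ∂P ≤
      ∫ ω, Real.exp (t * Real.log A) * ((1 - t) + t / A * Real.exp (X ω)) ∂P := by
    refine integral_mono hexp'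
      (((integrable_const _).add (hexp.const_mul _)).const_mul _) fun ω => ?_
    have h1 : Real.exp (t * X ω) =
        Real.exp (t * Real.log A) * Real.exp (t * (X ω - Real.log A)) := by
      rw [← Real.exp_add]; ring_nf
    have h2 := convexOn_exp.2 (mem_univ (X ω - Real.log A)) (mem_univ 0) ht.1.le
      (sub_nonneg.2 ht.2) (by ring)
    simp only [smul_eq_mul, mul_zero, add_zero, Real.exp_zero, mul_one, Real.exp_sub,
      Real.exp_log hA] at h2
    simp only [h1]
    refine mul_le_mul_of_nonneg_left (h2.trans_eq ?_) (Real.exp_pos _).le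
    ring
  rw [integral_const_mul, integral_add (integrable_const _) (hexp.const_mul _),
    integral_const_mul, ← hAdef] at h
  simpa [div_mul_cancel₀ _ hA.ne'] using h

lemma abs_log_integral_exp_sub_le {f g : Ω → ℝ} {C : ℝ} (hfg : ∀ ω, |f ω - g ω| ≤ C)
    (hf : Integrable (fun ω => Real.exp (f ω)) P) (hg : Integrable (fun ω => Real.exp (g ω)) P) :
    |Real.log (∫ ω, Real.exp (f ω) ∂P) - Real.log (∫ ω, Real.exp (g ω) ∂P)| ≤ C := by
  have key {f g : Ω → ℝ} (hfg : ∀ ω, f ω - g ω ≤ C)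
      (hf : Integrable (fun ω => Real.exp (f ω)) P)
      (hg : Integrable (fun ω => Real.exp (g ω)) P) :
      Real.log (∫ ω, Real.exp (f ω) ∂P) ≤ C + Real.log (∫ ω, Real.exp (g ω) ∂P) := by
    rw [Real.log_le_iff_le_exp (integral_exp_pos hf), Real.exp_add,
      Real.exp_log (integral_exp_pos hg), ← integral_const_mul]
    refine integral_mono hf (hg.const_mul _) fun ω => ?_
    simp only [← Real.exp_add]
    exact Real.exp_le_exp.2 (by linarith [hfg ω])
  rw [abs_sub_le_iff]
  constructor
  · linarith [key (fun ω => (le_abs_self _).trans (hfg ω)) hf hg]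
  · linarith [key (fun ω => (le_abs_self _).trans ((abs_sub_comm _ _).trans_le (hfg ω))) hg hf]

end LogMoment

section LogReturnMoments

variable {d : ℕ} {Ω : Type*} [MeasurableSpace Ω] {P : Measure Ω}
  {r : Ω → Fin d → ℝ} {γ δ : ℝ} {x : Fin d → ℝ}

lemma measurable_ip_exp (hrm : Measurable r) (x : Fin d → ℝ) :
    Measurable fun ω => ip x (fun i => Real.exp (r ω i)) := by
  unfold ip; fun_prop

lemma measurable_Gmap_exp (hrm : Measurable r) (x : Fin d → ℝ) :
    Measurable fun ω => Gmap x (fun i => Real.exp (r ω i)) :=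
  measurable_pi_lambda _ fun i => Measurable.div (by fun_prop) (measurable_ip_exp hrm x)

lemma integrable_log_ip_exp (hrm : Measurable r) (hint : ∀ i, Integrable (fun ω => r ω i) P)
    (hx : x ∈ stdSimplex ℝ (Fin d)) :
    Integrable (fun ω => Real.log (ip x (fun i => Real.exp (r ω i)))) P :=
  (integrable_finsetSum Finset.univ fun i _ => (hint i).abs).mono'
    (measurable_ip_exp hrm x).log.aestronglyMeasurable
    (Filter.Eventually.of_forall fun ω => abs_log_ip_exp_le hx (r ω))

variable [IsProbabilityMeasure P]

lemma exp_mul_log_ip_exp_le_one_add (hd : 0 < d) (hδ : δ ∈ Gam γ)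
    (hx : x ∈ stdSimplex ℝ (Fin d)) (y : Fin d → ℝ) :
    Real.exp (δ * Real.log (ip x (fun i => Real.exp (y i)))) ≤ 1 + ∑ i, Real.exp (γ * y i) :=
  (exp_mul_le_one_add_exp_mul hδ _).trans (by linarith [exp_mul_log_ip_exp_le hd hx y γ])

lemma integrable_exp_mul_log_ip_exp (hd : 0 < d) (hrm : Measurable r)
    (hexp : ∀ i, Integrable (fun ω => Real.exp (γ * r ω i)) P) (hδ : δ ∈ Gam γ)
    (hx : x ∈ stdSimplex ℝ (Fin d)) :
    Integrable (fun ω => Real.exp (δ * Real.log (ip x (fun i => Real.exp (r ω i))))) P :=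
  ((integrable_const 1).add (integrable_finsetSum Finset.univ fun i _ => hexp i)).mono'
    ((measurable_ip_exp hrm x).log.const_mul δ).exp.aestronglyMeasurable
    (Filter.Eventually.of_forall fun ω => by
      rw [Real.norm_of_nonneg (Real.exp_pos _).le]
      simpa using exp_mul_log_ip_exp_le_one_add hd hδ hx (r ω))

lemma abs_log_integral_exp_mul_log_ip_exp_le (hd : 0 < d) (hrm : Measurable r)
    (hexp : ∀ i, Integrable (fun ω => Real.exp (γ * r ω i)) P)
    (hint : ∀ i, Integrable (fun ω => r ω i) P) (hδ : δ ∈ Gam γ)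
    (hx : x ∈ stdSimplex ℝ (Fin d)) {U V : ℝ} (hU : 0 ≤ U)
    (hUle : ∀ i, |entropic γ P (fun ω => r ω i)| ≤ U)
    (hV : ∀ i, ∫ ω, |r ω i| ∂P ≤ V) :
    |Real.log (∫ ω, Real.exp (δ * Real.log (ip x (fun i => Real.exp (r ω i)))) ∂P)| ≤
      |δ| * (U + d * V + Real.log d / |γ|) := by
  set L := fun ω => Real.log (ip x (fun i => Real.exp (r ω i)))
  have hLint : Integrable L P := integrable_log_ip_exp hrm hint hx
  have hγ : γ ≠ 0 := by
    rintro rfl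
    obtain ⟨⟨h1, h2⟩, h3⟩ := hδ
    simp only [min_self, max_self] at h1 h2
    exact h3 (le_antisymm h2 h1)
  have hdR : (1 : ℝ) ≤ d := by exact_mod_cast hd
  have hlogd : 0 ≤ Real.log d := Real.log_nonneg hdR
  have hγpos : 0 < |γ| := abs_pos.2 hγ
  have hV0 : 0 ≤ V := (integral_nonneg fun ω => abs_nonneg _).trans (hV ⟨0, hd⟩)
  have hdV : 0 ≤ d * V := by positivity
  have hq : 0 ≤ Real.log d / |γ| := by positivity
  have hexpδ : Integrable (fun ω => Real.exp (δ * L ω)) P :=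
    integrable_exp_mul_log_ip_exp hd hrm hexp hδ hx
  have hexpγ : Integrable (fun ω => Real.exp (γ * L ω)) P :=
    integrable_exp_mul_log_ip_exp hd hrm hexp (self_mem_Gam hγ) hx
  have hlow : -(|δ| * (d * V)) ≤ Real.log (∫ ω, Real.exp (δ * L ω) ∂P) := by
    have h1 := integral_le_log_integral_exp (hLint.const_mul δ) hexpδ
    rw [integral_const_mul] at h1
    have h2 : |∫ ω, L ω ∂P| ≤ d * V := calc
      _ ≤ ∫ ω, |L ω| ∂P := abs_integral_le_integral_abs
      _ ≤ ∫ ω, ∑ i, |r ω i| ∂P := integral_mono hLint.abs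
        (integrable_finsetSum _ fun i _ => (hint i).abs) fun ω => abs_log_ip_exp_le hx (r ω)
      _ = ∑ i, ∫ ω, |r ω i| ∂P := integral_finsetSum _ fun i _ => (hint i).abs
      _ ≤ ∑ _i : Fin d, V := Finset.sum_le_sum fun i _ => hV i
      _ = d * V := by simp
    have h3 : |δ * ∫ ω, L ω ∂P| ≤ |δ| * (d * V) := by
      rw [abs_mul]; exact mul_le_mul_of_nonneg_left h2 (abs_nonneg _)
    linarith [neg_abs_le (δ * ∫ ω, L ω ∂P)]
  have hupγ : Real.log (∫ ω, Real.exp (γ * L ω) ∂P) ≤ Real.log d + |γ| * U := by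
    rw [Real.log_le_iff_le_exp (integral_exp_pos hexpγ), Real.exp_add,
      Real.exp_log (by linarith)]
    calc _ ≤ ∫ ω, ∑ i, Real.exp (γ * r ω i) ∂P := integral_mono hexpγ
          (integrable_finsetSum _ fun i _ => hexp i) fun ω => exp_mul_log_ip_exp_le hd hx (r ω) γ
      _ = ∑ i, ∫ ω, Real.exp (γ * r ω i) ∂P := integral_finsetSum _ fun i _ => hexp i
      _ ≤ ∑ _i : Fin d, Real.exp (|γ| * U) := Finset.sum_le_sum fun i _ => by
        rw [← Real.log_le_iff_le_exp (integral_exp_pos (hexp i))]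
        have h1 : Real.log (∫ ω, Real.exp (γ * r ω i) ∂P) =
            γ * entropic γ P (fun ω => r ω i) := by
          unfold entropic; field_simp
        rw [h1]
        refine (le_abs_self _).trans ?_
        rw [abs_mul]
        exact mul_le_mul_of_nonneg_left (hUle i) (abs_nonneg _)
      _ = _ := by simp
  obtain ⟨t, ht, rfl⟩ := exists_mul_eq_of_mem_Gam hδ
  have habs : |t * γ| = t * |γ| := by rw [abs_mul, abs_of_pos ht.1]
  have hup : Real.log (∫ ω, Real.exp (t * γ * L ω) ∂P) ≤
      |t * γ| * (U + Real.log d / |γ|) := by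
    have h1 := log_integral_exp_mul_le hexpγ ht (by simpa only [mul_assoc] using hexpδ)
    simp only [← mul_assoc] at h1
    refine h1.trans ((mul_le_mul_of_nonneg_left hupγ ht.1.le).trans_eq ?_)
    rw [habs]
    field_simp
    ring
  rw [abs_le]
  have hδ0 := abs_nonneg (t * γ)
  constructor
  · nlinarith [mul_nonneg hδ0 hU, mul_nonneg hδ0 hq]
  · nlinarith [mul_nonneg hδ0 hdV]

end LogReturnMoments

section Bellman

variable {d : ℕ} {Ω : Type*} [MeasurableSpace Ω] {P : Measure Ω}
  {r : Ω → Fin d → ℝ} {γ : ℝ} {v : (Fin d → ℝ) → ℝ → ℝ}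

lemma measurable_comp_Gmap_exp (hrm : Measurable r)
    (hvc : ContinuousOn (fun p : (Fin d → ℝ) × ℝ => v p.1 p.2) (stdSimplex ℝ (Fin d) ×ˢ Gam γ))
    {x : Fin d → ℝ} (hx : x ∈ stdSimplex ℝ (Fin d)) {δ : ℝ} (hδ : δ ∈ Gam γ) :
    Measurable fun ω => v (Gmap x (fun i => Real.exp (r ω i))) δ := by
  have hcont : Continuous fun y : stdSimplex ℝ (Fin d) => v y.1 δ :=
    hvc.comp_continuous (f := fun y : stdSimplex ℝ (Fin d) => (y.1, δ)) (by fun_prop)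
      fun y => ⟨y.2, hδ⟩
  exact hcont.measurable.comp ((measurable_Gmap_exp hrm x).subtype_mk
    (h := fun ω => Gmap_exp_mem_stdSimplex hx (r ω)))

/-- The moment `E[exp(δ ln⟨x,w⟩ + v(G(x,w), δ c))]`. -/
def bellmanMoment (P : Measure Ω) (r : Ω → Fin d → ℝ) (v : (Fin d → ℝ) → ℝ → ℝ) (c : ℝ)
    (δ : ℝ) (x : Fin d → ℝ) : ℝ :=
  ∫ ω, Real.exp (δ * Real.log (ip x (fun i => Real.exp (r ω i))) +
    v (Gmap x (fun i => Real.exp (r ω i))) (δ * c)) ∂P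

variable {c C : ℝ}

lemma entropic_eq_log_bellmanMoment {δ : ℝ} (hδ : δ ≠ 0) (x : Fin d → ℝ) (a : ℝ)
    (hpos : 0 < bellmanMoment P r v c δ x) :
    entropic δ P (fun ω => Real.log (ip x (fun i => Real.exp (r ω i))) + a +
      δ⁻¹ * v (Gmap x (fun i => Real.exp (r ω i))) (δ * c)) =
      a + δ⁻¹ * Real.log (bellmanMoment P r v c δ x) := by
  have h : ∀ ω, Real.exp (δ * (Real.log (ip x (fun i => Real.exp (r ω i))) + a +
      δ⁻¹ * v (Gmap x (fun i => Real.exp (r ω i))) (δ * c))) =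
      Real.exp (δ * a) * Real.exp (δ * Real.log (ip x (fun i => Real.exp (r ω i))) +
        v (Gmap x (fun i => Real.exp (r ω i))) (δ * c)) := fun ω => by
    rw [← Real.exp_add]
    congr 1
    field_simp
    ring
  unfold entropic
  simp only [h]
  rw [integral_const_mul]
  change _ * Real.log (_ * bellmanMoment P r v c δ x) = _
  rw [Real.log_mul (Real.exp_pos _).ne' hpos.ne', Real.log_exp]
  field_simp

variable [IsProbabilityMeasure P]

lemma bellmanMoment_integrand_le (hd : 0 < d) (hc : c ∈ Ioc (0 : ℝ) 1)
    (hvC : ∀ π ∈ stdSimplex ℝ (Fin d), ∀ δ ∈ Gam γ, |v π δ| ≤ C) {δ : ℝ} (hδ : δ ∈ Gam γ)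
    {x : Fin d → ℝ} (hx : x ∈ stdSimplex ℝ (Fin d)) (y : Fin d → ℝ) :
    ‖Real.exp (δ * Real.log (ip x (fun i => Real.exp (y i))) +
      v (Gmap x (fun i => Real.exp (y i))) (δ * c))‖ ≤
      (1 + ∑ i, Real.exp (γ * y i)) * Real.exp C := by
  rw [Real.norm_of_nonneg (Real.exp_pos _).le, Real.exp_add]
  exact mul_le_mul (exp_mul_log_ip_exp_le_one_add hd hδ hx y)
    (Real.exp_le_exp.2 ((le_abs_self _).trans
      (hvC _ (Gmap_exp_mem_stdSimplex hx y) _ (mul_mem_Gam hδ hc))))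
    (Real.exp_pos _).le (by positivity)

lemma integrable_bellmanMoment_bound
    (hexp : ∀ i, Integrable (fun ω => Real.exp (γ * r ω i)) P) (C : ℝ) :
    Integrable (fun ω => (1 + ∑ i, Real.exp (γ * r ω i)) * Real.exp C) P :=
  ((integrable_const 1).add (integrable_finsetSum Finset.univ fun i _ => hexp i)).mul_const _

lemma measurable_bellmanMoment_integrand (hrm : Measurable r) (hc : c ∈ Ioc (0 : ℝ) 1)
    (hvc : ContinuousOn (fun p : (Fin d → ℝ) × ℝ => v p.1 p.2) (stdSimplex ℝ (Fin d) ×ˢ Gam γ))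
    {δ : ℝ} (hδ : δ ∈ Gam γ) {x : Fin d → ℝ} (hx : x ∈ stdSimplex ℝ (Fin d)) :
    Measurable fun ω => Real.exp (δ * Real.log (ip x (fun i => Real.exp (r ω i))) +
      v (Gmap x (fun i => Real.exp (r ω i))) (δ * c)) :=
  (((measurable_ip_exp hrm x).log.const_mul δ).add
    (measurable_comp_Gmap_exp hrm hvc hx (mul_mem_Gam hδ hc))).exp

lemma integrable_bellmanMoment_integrand (hd : 0 < d) (hrm : Measurable r)
    (hc : c ∈ Ioc (0 : ℝ) 1) (hexp : ∀ i, Integrable (fun ω => Real.exp (γ * r ω i)) P)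
    (hvC : ∀ π ∈ stdSimplex ℝ (Fin d), ∀ δ ∈ Gam γ, |v π δ| ≤ C)
    (hvc : ContinuousOn (fun p : (Fin d → ℝ) × ℝ => v p.1 p.2) (stdSimplex ℝ (Fin d) ×ˢ Gam γ))
    {δ : ℝ} (hδ : δ ∈ Gam γ) {x : Fin d → ℝ} (hx : x ∈ stdSimplex ℝ (Fin d)) :
    Integrable (fun ω => Real.exp (δ * Real.log (ip x (fun i => Real.exp (r ω i))) +
      v (Gmap x (fun i => Real.exp (r ω i))) (δ * c))) P :=
  (integrable_bellmanMoment_bound hexp C).mono'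
    (measurable_bellmanMoment_integrand hrm hc hvc hδ hx).aestronglyMeasurable
    (Filter.Eventually.of_forall fun ω => bellmanMoment_integrand_le hd hc hvC hδ hx (r ω))

lemma continuous_bellmanMoment (hd : 0 < d) (hrm : Measurable r)
    (hc : c ∈ Ioc (0 : ℝ) 1) (hexp : ∀ i, Integrable (fun ω => Real.exp (γ * r ω i)) P)
    (hvC : ∀ π ∈ stdSimplex ℝ (Fin d), ∀ δ ∈ Gam γ, |v π δ| ≤ C)
    (hvc : ContinuousOn (fun p : (Fin d → ℝ) × ℝ => v p.1 p.2)
      (stdSimplex ℝ (Fin d) ×ˢ Gam γ)) :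
    Continuous fun q : Gam γ × stdSimplex ℝ (Fin d) => bellmanMoment P r v c q.1.1 q.2.1 := by
  unfold bellmanMoment
  refine continuous_of_dominated
    (fun q => (measurable_bellmanMoment_integrand hrm hc hvc q.1.2 q.2.2).aestronglyMeasurable)
    (fun q => Filter.Eventually.of_forall fun ω =>
      bellmanMoment_integrand_le hd hc hvC q.1.2 q.2.2 (r ω))
    (integrable_bellmanMoment_bound hexp C) (Filter.Eventually.of_forall fun ω => ?_)
  have hlog : Continuous fun q : Gam γ × stdSimplex ℝ (Fin d) =>
      Real.log (ip q.2.1 (fun i => Real.exp (r ω i))) :=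
    (continuous_log_ip_exp (r ω)).comp continuous_snd
  have hG : Continuous fun q : Gam γ × stdSimplex ℝ (Fin d) =>
      Gmap q.2.1 (fun i => Real.exp (r ω i)) :=
    (continuous_Gmap_exp (r ω)).comp continuous_snd
  have hδ : Continuous fun q : Gam γ × stdSimplex ℝ (Fin d) => q.1.1 := by fun_prop
  have hv : Continuous fun q : Gam γ × stdSimplex ℝ (Fin d) =>
      v (Gmap q.2.1 (fun i => Real.exp (r ω i))) (q.1.1 * c) :=
    hvc.comp_continuous (hG.prodMk (hδ.mul_const c)) fun q =>
      ⟨Gmap_exp_mem_stdSimplex q.2.2 (r ω), mul_mem_Gam q.1.2 hc⟩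
  exact ((hδ.mul hlog).add hv).rexp

end Bellman

/-- under (A.1), for `α > 0`, the discounted Bellman operator `T` maps
bounded continuous functions on `S × Γ` to bounded continuous functions, with
`‖Tv‖ ≤ |γ|(z⁺ - z⁻) + ‖v‖`. -/
theorem bellman_operator_C_Feller {d : ℕ} (hd : 0 < d) {Ω : Type*} [MeasurableSpace Ω]
    (P : Measure Ω) [IsProbabilityMeasure P]
    (st : ℝ) (hst : st ∈ Ioo (0 : ℝ) 1)
    (s : (Fin d → ℝ) → (Fin d → ℝ) → ℝ)
    (hs : ∀ x ∈ stdSimplex ℝ (Fin d), ∀ y ∈ stdSimplex ℝ (Fin d), s x y ∈ Icc st 1)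
    (hscont : ContinuousOn (fun p : (Fin d → ℝ) × (Fin d → ℝ) => s p.1 p.2)
      (stdSimplex ℝ (Fin d) ×ˢ stdSimplex ℝ (Fin d)))
    (γ : ℝ) (hγ : γ ≠ 0) (r : Ω → Fin d → ℝ) (hrm : Measurable r)
    (hA1exp : ∀ i, Integrable (fun ω => Real.exp (γ * r ω i)) P)
    (hA1int : ∀ i, Integrable (fun ω => r ω i) P)
    (α : ℝ) (hα : 0 < α)
    (zminus zplus : ℝ)
    (hzminus : zminus =
      -|Finset.univ.inf' (Finset.univ_nonempty_iff.mpr ⟨⟨0, hd⟩⟩)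
          (fun i => entropic γ P (fun ω => r ω i))| -
        d * Finset.univ.sup' (Finset.univ_nonempty_iff.mpr ⟨⟨0, hd⟩⟩)
          (fun i => ∫ ω, |r ω i| ∂P) -
        Real.log d / |γ| + Real.log st)
    (hzplus : zplus =
      |Finset.univ.sup' (Finset.univ_nonempty_iff.mpr ⟨⟨0, hd⟩⟩)
          (fun i => entropic γ P (fun ω => r ω i))| +
        d * Finset.univ.sup' (Finset.univ_nonempty_iff.mpr ⟨⟨0, hd⟩⟩)
          (fun i => ∫ ω, |r ω i| ∂P) +
        Real.log d / |γ|)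
    (v : (Fin d → ℝ) → ℝ → ℝ)
    (hvb : ∃ C : ℝ, ∀ π ∈ stdSimplex ℝ (Fin d), ∀ δ ∈ Gam γ, |v π δ| ≤ C)
    (hvc : ContinuousOn (fun p : (Fin d → ℝ) × ℝ => v p.1 p.2)
      (stdSimplex ℝ (Fin d) ×ˢ Gam γ)) :
    (∃ C : ℝ, ∀ π ∈ stdSimplex ℝ (Fin d), ∀ δ ∈ Gam γ, |TOp P s r α v π δ| ≤ C) ∧
      ContinuousOn (fun p : (Fin d → ℝ) × ℝ => TOp P s r α v p.1 p.2)
        (stdSimplex ℝ (Fin d) ×ˢ Gam γ) ∧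
      supNormSG γ (TOp P s r α v) ≤ |γ| * (zplus - zminus) + supNormSG γ v := by
  set S := stdSimplex ℝ (Fin d)
  obtain ⟨C, hvC⟩ := hvb
  have hc : Real.exp (-α) ∈ Ioc (0 : ℝ) 1 :=
    ⟨Real.exp_pos _, Real.exp_le_one_iff.2 (by linarith)⟩
  have hne : S.Nonempty := ⟨_, single_mem_stdSimplex ℝ (⟨0, hd⟩ : Fin d)⟩
  have hspos : ∀ x ∈ S, ∀ y ∈ S, 0 < s x y := fun x hx y hy => hst.1.trans_le (hs x hx y hy).1
  have hexpint {δ : ℝ} (hδ : δ ∈ Gam γ) {x : Fin d → ℝ} (hx : x ∈ S) :=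
    integrable_bellmanMoment_integrand hd hrm hc hA1exp hvC hvc hδ hx
  have hpos {δ : ℝ} (hδ : δ ∈ Gam γ) {x : Fin d → ℝ} (hx : x ∈ S) :
      0 < bellmanMoment P r v (Real.exp (-α)) δ x := integral_exp_pos (hexpint hδ hx)
  have hTOp {π : Fin d → ℝ} {δ : ℝ} (hδ : δ ∈ Gam γ) : TOp P s r α v π δ =
      δ * sSup ((fun x => Real.log (s π x) +
        δ⁻¹ * Real.log (bellmanMoment P r v (Real.exp (-α)) δ x)) '' S) := by
    unfold TOp
    congr 2
    exact image_congr fun x hx => entropic_eq_log_bellmanMoment hδ.2 x _ (hpos hδ hx)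
  have hvN : ∀ π ∈ S, ∀ δ ∈ Gam γ, |v π δ| ≤ supNormSG γ v := fun π hπ δ hδ =>
    le_csSup ⟨C, by rintro _ ⟨π, hπ, δ, hδ, rfl⟩; exact hvC π hπ δ hδ⟩ ⟨π, hπ, δ, hδ, rfl⟩
  have hbound : ∀ π ∈ S, ∀ δ ∈ Gam γ,
      |TOp P s r α v π δ| ≤ |γ| * (zplus - zminus) + supNormSG γ v := by
    intro π hπ δ hδ
    have hδ0 : δ ≠ 0 := hδ.2
    have hδpos : 0 < |δ| := abs_pos.2 hδ0
    set e := fun i => entropic γ P (fun ω => r ω i)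
    set m := fun i => ∫ ω, |r ω i| ∂P
    have hlogst : Real.log st ≤ 0 := Real.log_nonpos hst.1.le hst.2.le
    have hUle : ∀ i, |e i| ≤ |Finset.univ.sup' (Finset.univ_nonempty_iff.mpr ⟨⟨0, hd⟩⟩) e| +
        |Finset.univ.inf' (Finset.univ_nonempty_iff.mpr ⟨⟨0, hd⟩⟩) e| := fun i => by
      have h1 := Finset.le_sup' e (Finset.mem_univ i)
      have h2 := Finset.inf'_le e (Finset.mem_univ i)
      rw [abs_le]
      constructor
      · have := neg_abs_le (Finset.univ.inf' (Finset.univ_nonempty_iff.mpr ⟨⟨0, hd⟩⟩) e)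
        have := abs_nonneg (Finset.univ.sup' (Finset.univ_nonempty_iff.mpr ⟨⟨0, hd⟩⟩) e)
        linarith
      · have := le_abs_self (Finset.univ.sup' (Finset.univ_nonempty_iff.mpr ⟨⟨0, hd⟩⟩) e)
        have := abs_nonneg (Finset.univ.inf' (Finset.univ_nonempty_iff.mpr ⟨⟨0, hd⟩⟩) e)
        linarith
    have hV : ∀ i, m i ≤ Finset.univ.sup' (Finset.univ_nonempty_iff.mpr ⟨⟨0, hd⟩⟩) m :=
      fun i => Finset.le_sup' m (Finset.mem_univ i)
    have hd1 : (1 : ℝ) ≤ d := by exact_mod_cast hd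
    have hV0 : 0 ≤ Finset.univ.sup' (Finset.univ_nonempty_iff.mpr ⟨⟨0, hd⟩⟩) m :=
      (integral_nonneg fun ω => abs_nonneg _).trans (hV ⟨0, hd⟩)
    set V := Finset.univ.sup' (Finset.univ_nonempty_iff.mpr ⟨⟨0, hd⟩⟩) m
    set U₁ := Finset.univ.sup' (Finset.univ_nonempty_iff.mpr ⟨⟨0, hd⟩⟩) e
    set U₂ := Finset.univ.inf' (Finset.univ_nonempty_iff.mpr ⟨⟨0, hd⟩⟩) e
    have hdV : 0 ≤ d * V := by positivity
    have hq : 0 ≤ Real.log d / |γ| := div_nonneg (Real.log_nonneg hd1) (abs_nonneg _)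
    have hδγ : |δ| ≤ |γ| := by
      obtain ⟨t, ht, rfl⟩ := exists_mul_eq_of_mem_Gam hδ
      rw [abs_mul, abs_of_pos ht.1]
      exact mul_le_of_le_one_left (abs_nonneg _) ht.2
    have hterm : ∀ x ∈ S, |Real.log (s π x) +
        δ⁻¹ * Real.log (bellmanMoment P r v (Real.exp (-α)) δ x)| ≤
        (zplus - zminus) + |δ|⁻¹ * supNormSG γ v := by
      intro x hx
      have h1 := abs_log_integral_exp_mul_log_ip_exp_le hd hrm hA1exp hA1int hδ hx
        (by positivity) hUle hV
      have h2 := abs_log_integral_exp_sub_le (P := P) (C := supNormSG γ v)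
        (fun ω => by
          rw [add_sub_cancel_left]
          exact hvN _ (Gmap_exp_mem_stdSimplex hx (r ω)) _ (mul_mem_Gam hδ hc))
        (hexpint hδ hx) (integrable_exp_mul_log_ip_exp hd hrm hA1exp hδ hx)
      change |Real.log (bellmanMoment P r v (Real.exp (-α)) δ x) - _| ≤ _ at h2
      have h3 : |Real.log (s π x)| ≤ -Real.log st := by
        have := hs π hπ x hx
        rw [abs_of_nonpos (Real.log_nonpos (hspos π hπ x hx).le this.2)]
        exact neg_le_neg (Real.log_le_log hst.1 this.1)
      have h4 : |Real.log (bellmanMoment P r v (Real.exp (-α)) δ x)| ≤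
          |δ| * (|U₁| + |U₂| + d * V + Real.log d / |γ|) + supNormSG γ v := by
        have := abs_sub_abs_le_abs_sub (Real.log (bellmanMoment P r v (Real.exp (-α)) δ x))
          (Real.log (∫ ω, Real.exp (δ * Real.log (ip x (fun i => Real.exp (r ω i)))) ∂P))
        linarith
      have h5 : |δ⁻¹ * Real.log (bellmanMoment P r v (Real.exp (-α)) δ x)| ≤
          (|U₁| + |U₂| + d * V + Real.log d / |γ|) + |δ|⁻¹ * supNormSG γ v := by
        rw [abs_mul, abs_inv]
        refine (mul_le_mul_of_nonneg_left h4 (inv_nonneg.2 hδpos.le)).trans_eq ?_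
        rw [mul_add, inv_mul_cancel_left₀ hδpos.ne']
      refine (abs_add_le _ _).trans ((add_le_add h3 h5).trans ?_)
      rw [hzplus, hzminus]
      linarith
    have hzz : 0 ≤ zplus - zminus := by
      rw [hzplus, hzminus]
      linarith [abs_nonneg U₁, abs_nonneg U₂]
    rw [hTOp hδ, abs_mul]
    have hsup : |sSup ((fun x => Real.log (s π x) +
        δ⁻¹ * Real.log (bellmanMoment P r v (Real.exp (-α)) δ x)) '' S)| ≤
        (zplus - zminus) + |δ|⁻¹ * supNormSG γ v := by
      obtain ⟨x₀, hx₀⟩ := hne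
      rw [abs_le]
      constructor
      · refine (abs_le.1 (hterm x₀ hx₀)).1.trans (le_csSup
          ⟨(zplus - zminus) + |δ|⁻¹ * supNormSG γ v, ?_⟩ (mem_image_of_mem _ hx₀))
        exact forall_mem_image.2 fun x hx => (abs_le.1 (hterm x hx)).2
      · exact csSup_le (Set.Nonempty.image _ ⟨x₀, hx₀⟩)
          (forall_mem_image.2 fun x hx => (abs_le.1 (hterm x hx)).2)
    refine (mul_le_mul_of_nonneg_left hsup hδpos.le).trans ?_
    rw [mul_add, mul_inv_cancel_left₀ hδpos.ne']
    linarith [mul_le_mul_of_nonneg_right hδγ hzz]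
  refine ⟨⟨_, hbound⟩, ?_, ?_⟩
  · rw [continuousOn_iff_continuous_domRestrict]
    have hrestrict : (S ×ˢ Gam γ).domRestrict
        (fun p : (Fin d → ℝ) × ℝ => TOp P s r α v p.1 p.2) =
        fun p : ↥(S ×ˢ Gam γ) => p.1.2 * sSup ((fun x : S => Real.log (s p.1.1 x.1) +
          p.1.2⁻¹ * Real.log (bellmanMoment P r v (Real.exp (-α)) p.1.2 x.1)) '' univ) := by
      funext p
      rw [domRestrict_apply, hTOp p.2.2, image_univ, image_eq_range]
    rw [hrestrict]
    have : CompactSpace S := isCompact_iff_compactSpace.1 (isCompact_stdSimplex ℝ (Fin d))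
    refine Continuous.mul (by fun_prop) (IsCompact.continuous_sSup isCompact_univ ?_)
    have hδc : Continuous fun q : ↥(S ×ˢ Gam γ) × S => q.1.1.2 := by fun_prop
    have hsc : Continuous fun q : ↥(S ×ˢ Gam γ) × S => s q.1.1.1 q.2.1 :=
      hscont.comp_continuous (f := fun q : ↥(S ×ˢ Gam γ) × S => (q.1.1.1, q.2.1))
        (by fun_prop) fun q => ⟨q.1.2.1, q.2.2⟩
    have hMc : Continuous fun q : ↥(S ×ˢ Gam γ) × S =>
        bellmanMoment P r v (Real.exp (-α)) q.1.1.2 q.2.1 :=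
      (continuous_bellmanMoment hd hrm hc hA1exp hvC hvc).comp
        (g := fun q : Gam γ × S => bellmanMoment P r v (Real.exp (-α)) q.1.1 q.2.1)
        (f := fun q : ↥(S ×ˢ Gam γ) × S => ((⟨q.1.1.2, q.1.2.2⟩ : Gam γ), q.2))
        ((hδc.subtype_mk _).prodMk continuous_snd)
    exact (hsc.log fun q => (hspos _ q.1.2.1 _ q.2.2).ne').add
      ((hδc.inv₀ fun q => q.1.2.2.2).mul (hMc.log fun q => (hpos q.1.2.2 q.2.2).ne'))
  · obtain ⟨x₀, hx₀⟩ := hne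
    refine csSup_le ⟨_, x₀, hx₀, γ, self_mem_Gam hγ, rfl⟩ ?_
    rintro _ ⟨π, hπ, δ, hδ, rfl⟩
    exact hbound π hπ δ hδ
end
end

section
/- Assume (A.1) and fix π̂ ∈ S. For each α ∈ (0,1) let v_α : S × Γ → ℝ be a bounded solution of the discounted Bellman equation, and set v̄_α(π, δ) := v_α(π, δ) − v_α(π̂, δ). Then the family {π ↦ v̄_α(π, δ) : α ∈ (0,1), δ ∈ Γ} is uniformly bounded and equicontinuous; specifically, for all π, π̃ ∈ S, α ∈ (0,1) and δ ∈ Γ: |v̄_α(π, δ)| ≤ |γ| · |ln s̃| and |v̄_α(π, δ) − v̄_α(π̃, δ)| ≤ |γ| · sup_{π' ∈ S} | ln( s(π, π') / s(π̃, π') ) |. -/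
open MeasureTheory Set

noncomputable section

theorem sSup_image_le_sSup_image_add {ι : Type*} {S : Set ι} (hS : S.Nonempty) {f g : ι → ℝ}
    {M : ℝ} (h : ∀ x ∈ S, |f x - g x| ≤ M) (hg : BddAbove (g '' S)) :
    sSup (f '' S) ≤ sSup (g '' S) + M := by
  refine csSup_le (hS.image f) ?_
  rintro _ ⟨x, hx, rfl⟩
  linarith [le_csSup hg (mem_image_of_mem g hx), (abs_le.mp (h x hx)).2]

theorem bddAbove_image_of_abs_sub_le {ι : Type*} {S : Set ι} {f g : ι → ℝ} {M : ℝ}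
    (h : ∀ x ∈ S, |f x - g x| ≤ M) (hf : BddAbove (f '' S)) : BddAbove (g '' S) := by
  obtain ⟨B, hB⟩ := hf
  refine ⟨B + M, ?_⟩
  rintro _ ⟨x, hx, rfl⟩
  linarith [hB (mem_image_of_mem f hx), (abs_le.mp (h x hx)).1]

/-- Suprema of two uniformly close functions are close. No boundedness is needed: the images are
either both bounded above, or both suprema take the default value `0`. -/
theorem abs_sSup_image_sub_le {ι : Type*} {S : Set ι} (hS : S.Nonempty) {f g : ι → ℝ}
    {M : ℝ} (h : ∀ x ∈ S, |f x - g x| ≤ M) :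
    |sSup (f '' S) - sSup (g '' S)| ≤ M := by
  have h' : ∀ x ∈ S, |g x - f x| ≤ M := fun x hx => abs_sub_comm (f x) (g x) ▸ h x hx
  by_cases hf : BddAbove (f '' S)
  · have hg := bddAbove_image_of_abs_sub_le h hf
    rw [abs_le]
    constructor <;>
      linarith [sSup_image_le_sSup_image_add hS h hg, sSup_image_le_sSup_image_add hS h' hf]
  · have hg : ¬ BddAbove (g '' S) := fun hg => hf (bddAbove_image_of_abs_sub_le h' hg)
    obtain ⟨x, hx⟩ := hS
    rw [Real.sSup_of_not_bddAbove hf, Real.sSup_of_not_bddAbove hg, sub_self, abs_zero]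
    exact (abs_nonneg _).trans (h x hx)

/-- Entropic utilities of two translates of `A + B` differ by at most the difference of the
translations, also when the exponential is not integrable. -/
theorem abs_entropic_add_const_sub_le {Ω : Type*} [MeasurableSpace Ω] (P : Measure Ω)
    {δ : ℝ} (hδ : δ ≠ 0) (A B : Ω → ℝ) (a b : ℝ) :
    |entropic δ P (fun ω => A ω + a + B ω) - entropic δ P (fun ω => A ω + b + B ω)| ≤
      |a - b| := by
  have key (c : ℝ) : ∫ ω, Real.exp (δ * (A ω + c + B ω)) ∂P =
      Real.exp (δ * c) * ∫ ω, Real.exp (δ * (A ω + B ω)) ∂P := by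
    rw [← integral_const_mul]
    congr 1 with ω
    rw [← Real.exp_add]
    ring_nf
  simp only [entropic, key]
  by_cases hJ : ∫ ω, Real.exp (δ * (A ω + B ω)) ∂P = 0
  · simp [hJ]
  · rw [Real.log_mul (Real.exp_ne_zero _) hJ, Real.log_mul (Real.exp_ne_zero _) hJ,
      Real.log_exp, Real.log_exp]
    refine le_of_eq (congrArg _ ?_)
    field_simp
    ring

theorem abs_TOp_sub_le {d : ℕ} (hd : 0 < d) {Ω : Type*} [MeasurableSpace Ω] (P : Measure Ω)
    (s : (Fin d → ℝ) → (Fin d → ℝ) → ℝ) (r : Ω → Fin d → ℝ) (α : ℝ)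
    (v : (Fin d → ℝ) → ℝ → ℝ) {δ M : ℝ} (hδ : δ ≠ 0) {π πt : Fin d → ℝ}
    (hM : ∀ π' ∈ stdSimplex ℝ (Fin d), |Real.log (s π π') - Real.log (s πt π')| ≤ M) :
    |TOp P s r α v π δ - TOp P s r α v πt δ| ≤ |δ| * M := by
  have hne : (stdSimplex ℝ (Fin d)).Nonempty := ⟨_, single_mem_stdSimplex ℝ (⟨0, hd⟩ : Fin d)⟩
  simp only [TOp]
  rw [← mul_sub, abs_mul]
  exact mul_le_mul_of_nonneg_left (abs_sSup_image_sub_le hne fun π' hπ' =>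
    (abs_entropic_add_const_sub_le P hδ _ _ _ _).trans (hM π' hπ')) (abs_nonneg _)

theorem abs_le_abs_of_mem_Gam {γ δ : ℝ} (h : δ ∈ Gam γ) : |δ| ≤ |γ| := by
  obtain ⟨⟨h₁, h₂⟩, -⟩ := h
  rw [abs_le]
  constructor
  · exact (le_min (neg_abs_le γ) (neg_nonpos.mpr (abs_nonneg γ))).trans h₁
  · exact h₂.trans (max_le (le_abs_self γ) (abs_nonneg γ))

theorem abs_log_sub_log_le {st a b : ℝ} (hst : 0 < st) (ha : a ∈ Icc st 1)
    (hb : b ∈ Icc st 1) : |Real.log a - Real.log b| ≤ |Real.log st| := by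
  have h₁ := Real.log_le_log hst ha.1
  have h₂ := Real.log_le_log hst hb.1
  have h₃ := Real.log_nonpos (hst.le.trans ha.1) ha.2
  have h₄ := Real.log_nonpos (hst.le.trans hb.1) hb.2
  rw [abs_of_nonpos (h₁.trans h₃), abs_le]
  constructor <;> linarith

/-- under (A.1), with `π̂ ∈ S` fixed and, for each `α ∈ (0,1)`, a bounded
solution `v_α` of the discounted Bellman equation, the family
`{π ↦ v_α(π,δ) − v_α(π̂,δ)}` is uniformly bounded by `|γ||ln s̃|` and equicontinuous:
`|v̄_α(π,δ) − v̄_α(π̃,δ)| ≤ |γ| sup_{π'} |ln(s(π,π')/s(π̃,π'))|`. -/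
theorem centered_discounted_solutions_unif_bounded_equicontinuous
    {d : ℕ} (hd : 0 < d) {Ω : Type*} [MeasurableSpace Ω]
    (P : Measure Ω) [IsProbabilityMeasure P]
    (st : ℝ) (hst : st ∈ Ioo (0 : ℝ) 1)
    (s : (Fin d → ℝ) → (Fin d → ℝ) → ℝ)
    (hs : ∀ x ∈ stdSimplex ℝ (Fin d), ∀ y ∈ stdSimplex ℝ (Fin d), s x y ∈ Icc st 1)
    (hscont : ContinuousOn (fun p : (Fin d → ℝ) × (Fin d → ℝ) => s p.1 p.2)
      (stdSimplex ℝ (Fin d) ×ˢ stdSimplex ℝ (Fin d)))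
    (γ : ℝ) (hγ : γ ≠ 0) (r : Ω → Fin d → ℝ) (hrm : Measurable r)
    (hA1exp : ∀ i, Integrable (fun ω => Real.exp (γ * r ω i)) P)
    (hA1int : ∀ i, Integrable (fun ω => r ω i) P)
    (pihat : Fin d → ℝ) (hpihat : pihat ∈ stdSimplex ℝ (Fin d))
    (vfam : ℝ → (Fin d → ℝ) → ℝ → ℝ)
    (hvb : ∀ α ∈ Ioo (0 : ℝ) 1,
      ∃ C : ℝ, ∀ π ∈ stdSimplex ℝ (Fin d), ∀ δ ∈ Gam γ, |vfam α π δ| ≤ C)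
    (hvbell : ∀ α ∈ Ioo (0 : ℝ) 1, ∀ π ∈ stdSimplex ℝ (Fin d), ∀ δ ∈ Gam γ,
      vfam α π δ = TOp P s r α (vfam α) π δ) :
    ∀ α ∈ Ioo (0 : ℝ) 1, ∀ δ ∈ Gam γ,
      ∀ π ∈ stdSimplex ℝ (Fin d), ∀ πt ∈ stdSimplex ℝ (Fin d),
        |vfam α π δ - vfam α pihat δ| ≤ |γ| * |Real.log st| ∧
        |(vfam α π δ - vfam α pihat δ) - (vfam α πt δ - vfam α pihat δ)| ≤
          |γ| * sSup ((fun π' => |Real.log (s π π' / s πt π')|) '' stdSimplex ℝ (Fin d)) := by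
  intro α hα δ hδ π hπ πt hπt
  have hδ0 : δ ≠ 0 := hδ.2
  have hlog : ∀ x ∈ stdSimplex ℝ (Fin d), ∀ y ∈ stdSimplex ℝ (Fin d),
      ∀ π' ∈ stdSimplex ℝ (Fin d),
        |Real.log (s x π') - Real.log (s y π')| ≤ |Real.log st| :=
    fun x hx y hy π' hπ' => abs_log_sub_log_le hst.1 (hs x hx π' hπ') (hs y hy π' hπ')
  have hpos : ∀ x ∈ stdSimplex ℝ (Fin d), ∀ y ∈ stdSimplex ℝ (Fin d), s x y ≠ 0 :=
    fun x hx y hy => (hst.1.trans_le (hs x hx y hy).1).ne'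
  have hdiv : ∀ π' ∈ stdSimplex ℝ (Fin d),
      Real.log (s π π' / s πt π') = Real.log (s π π') - Real.log (s πt π') :=
    fun π' hπ' => Real.log_div (hpos π hπ π' hπ') (hpos πt hπt π' hπ')
  have hbdd : BddAbove
      ((fun π' => |Real.log (s π π' / s πt π')|) '' stdSimplex ℝ (Fin d)) := by
    refine ⟨|Real.log st|, ?_⟩
    rintro _ ⟨π', hπ', rfl⟩
    simpa only [hdiv π' hπ'] using hlog π hπ πt hπt π' hπ'
  rw [sub_sub_sub_cancel_right, hvbell α hα π hπ δ hδ, hvbell α hα πt hπt δ hδ,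
    hvbell α hα pihat hpihat δ hδ]
  constructor
  · exact (abs_TOp_sub_le hd P s r α _ hδ0 (hlog π hπ pihat hpihat)).trans
      (mul_le_mul_of_nonneg_right (abs_le_abs_of_mem_Gam hδ) (abs_nonneg _))
  · refine (abs_TOp_sub_le hd P s r α _ hδ0 fun π' hπ' => ?_).trans
      (mul_le_mul_of_nonneg_right (abs_le_abs_of_mem_Gam hδ) (Real.sSup_nonneg ?_))
    · rw [← hdiv π' hπ']
      exact le_csSup hbdd (mem_image_of_mem _ hπ')
    · rintro _ ⟨π', -, rfl⟩
      exact abs_nonneg _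
end
end
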